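/- arXiv:2402.06310 — 3 statements merged into one kernel-verified Lean document; each statement's English description precedes it below -/
import Mathlib

section
/- Let ξ, ξ̄ : Fin n × Fin 2 → ℂ be orthonormal (‖ξ‖ = ‖ξ̄‖ = 1 and ⟨ξ, ξ̄⟩ = 0) and let g_S be the associated spin g-tensor. Then for all real unit vectors a, b ∈ ℝ³ (Σᵢ aᵢ² = 1 and Σⱼ bⱼ² = 1), |Σ_{i,j} aᵢ · g_S(i, j) · bⱼ| ≤ 2. Equivalently, every singular value of g_S is at most 2. -/
open Matrix Complex

/-- The three Pauli matrices: `pauli 0 = σ₁`, `pauli 1 = σ₂`, `pauli 2 = σ₃`. -/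
noncomputable def pauli : Fin 3 → Matrix (Fin 2) (Fin 2) ℂ
  | 0 => !![0, 1; 1, 0]
  | 1 => !![0, -Complex.I; Complex.I, 0]
  | 2 => !![1, 0; 0, -1]

/-- The Kramers partner of a vector `ξ : ℂⁿ ⊗ ℂ²` (spin index `0` = up, `1` = down):
`ξ̄(a,0) = conj ξ(a,1)`, `ξ̄(a,1) = -conj ξ(a,0)`. -/
noncomputable def kramers {n : ℕ} (ξ : Fin n × Fin 2 → ℂ) : Fin n × Fin 2 → ℂ :=
  fun p => if p.2 = 0 then (starRingEnd ℂ) (ξ (p.1, 1)) else -(starRingEnd ℂ) (ξ (p.1, 0))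

/-- Inner product `⟨u, v⟩ = Σ_{a,s} conj(u(a,s)) · v(a,s)` on `ℂⁿ ⊗ ℂ²`. -/
noncomputable def inner' {n : ℕ} (u v : Fin n × Fin 2 → ℂ) : ℂ :=
  ∑ p : Fin n × Fin 2, (starRingEnd ℂ) (u p) * v p

/-- Norm `‖u‖ = √⟨u,u⟩`. -/
noncomputable def norm' {n : ℕ} (u : Fin n × Fin 2 → ℂ) : ℝ :=
  Real.sqrt (inner' u u).re

/-- Action of the spin operator `σᵢ` on `ℂⁿ ⊗ ℂ²`:
`(σᵢ ξ)(a, s) = Σ_{s'} σᵢ(s, s') · ξ(a, s')`. -/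
noncomputable def spinAct {n : ℕ} (i : Fin 3) (ξ : Fin n × Fin 2 → ℂ) : Fin n × Fin 2 → ℂ :=
  fun p => ∑ s' : Fin 2, pauli i p.2 s' * ξ (p.1, s')

/-- Reduced spin density matrix `ρ_S(ξ)(s,s') = Σ_a ξ(a,s) · conj(ξ(a,s'))`. -/
noncomputable def rhoS {n : ℕ} (ξ : Fin n × Fin 2 → ℂ) : Matrix (Fin 2) (Fin 2) ℂ :=
  Matrix.of fun s s' => ∑ a : Fin n, ξ (a, s) * (starRingEnd ℂ) (ξ (a, s'))

/-- The 2×2 matrix of matrix elements of `σᵢ` in the pair `(ξ, ξ̄)`. -/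
noncomputable def SigmaMat {n : ℕ} (ξ ξb : Fin n × Fin 2 → ℂ) (i : Fin 3) :
    Matrix (Fin 2) (Fin 2) ℂ :=
  !![inner' ξ (spinAct i ξ), inner' ξ (spinAct i ξb);
     inner' ξb (spinAct i ξ), inner' ξb (spinAct i ξb)]

/-- The spin g-tensor of the pair `(ξ, ξ̄)`: `g_S(i,j) = Tr(Σᵢ σⱼ)`. -/
noncomputable def gS {n : ℕ} (ξ ξb : Fin n × Fin 2 → ℂ) : Matrix (Fin 3) (Fin 3) ℂ :=
  Matrix.of fun i j => (SigmaMat ξ ξb i * pauli j).trace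

lemma unitary_aux (a0 a1 a2 : ℝ) (h : a0 ^ 2 + a1 ^ 2 + a2 ^ 2 = 1) (u v : ℂ) :
    ‖(a2 : ℂ) * u + (a0 - a1 * Complex.I) * v‖ ^ 2 + ‖(a0 + a1 * Complex.I) * u - a2 * v‖ ^ 2
      = ‖u‖ ^ 2 + ‖v‖ ^ 2 := by
  simp only [Complex.sq_norm, Complex.normSq_apply]
  simp
  linear_combination (u.re ^ 2 + u.im ^ 2 + v.re ^ 2 + v.im ^ 2) * h

lemma amgm_aux (u v : ℂ) : ‖(starRingEnd ℂ) u * v‖ ≤ (‖u‖ ^ 2 + ‖v‖ ^ 2) / 2 := by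
  rw [norm_mul, RCLike.norm_conj]
  nlinarith [sq_nonneg (‖u‖ - ‖v‖)]

/-- Contribution of a single orbital index: spinors `(x0, x1)` and `(y0, y1)`. -/
noncomputable def locT (a b : Fin 3 → ℝ) (x0 x1 y0 y1 : ℂ) : ℂ :=
  (starRingEnd ℂ) x0 * ((a 2 : ℂ) * (b 2 * x0 + (b 0 + b 1 * Complex.I) * y0)
      + (a 0 - a 1 * Complex.I) * (b 2 * x1 + (b 0 + b 1 * Complex.I) * y1))
  + (starRingEnd ℂ) x1 * ((a 0 + a 1 * Complex.I) * (b 2 * x0 + (b 0 + b 1 * Complex.I) * y0)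
      - a 2 * (b 2 * x1 + (b 0 + b 1 * Complex.I) * y1))
  + (starRingEnd ℂ) y0 * ((a 2 : ℂ) * ((b 0 - b 1 * Complex.I) * x0 - b 2 * y0)
      + (a 0 - a 1 * Complex.I) * ((b 0 - b 1 * Complex.I) * x1 - b 2 * y1))
  + (starRingEnd ℂ) y1 * ((a 0 + a 1 * Complex.I) * ((b 0 - b 1 * Complex.I) * x0 - b 2 * y0)
      - a 2 * ((b 0 - b 1 * Complex.I) * x1 - b 2 * y1))

lemma locT_le (a b : Fin 3 → ℝ) (ha : a 0 ^ 2 + a 1 ^ 2 + a 2 ^ 2 = 1)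
    (hb : b 0 ^ 2 + b 1 ^ 2 + b 2 ^ 2 = 1) (x0 x1 y0 y1 : ℂ) :
    ‖locT a b x0 x1 y0 y1‖ ≤ (‖x0‖ ^ 2 + ‖x1‖ ^ 2) + (‖y0‖ ^ 2 + ‖y1‖ ^ 2) := by
  have hb' : b 0 ^ 2 + (-b 1) ^ 2 + b 2 ^ 2 = 1 := by rw [neg_sq]; exact hb
  have e0 := unitary_aux (b 0) (-b 1) (b 2) hb' x0 y0
  have e1 := unitary_aux (b 0) (-b 1) (b 2) hb' x1 y1
  simp only [Complex.ofReal_neg, neg_mul, sub_neg_eq_add, ← sub_eq_add_neg] at e0 e1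
  have f0 := unitary_aux (a 0) (a 1) (a 2) ha (b 2 * x0 + (b 0 + b 1 * Complex.I) * y0)
    (b 2 * x1 + (b 0 + b 1 * Complex.I) * y1)
  have f1 := unitary_aux (a 0) (a 1) (a 2) ha ((b 0 - b 1 * Complex.I) * x0 - b 2 * y0)
    ((b 0 - b 1 * Complex.I) * x1 - b 2 * y1)
  unfold locT
  refine (norm_add_le_of_le (norm_add_le_of_le (norm_add_le_of_le (amgm_aux _ _) (amgm_aux _ _))
    (amgm_aux _ _)) (amgm_aux _ _)).trans ?_
  linarith

lemma norm_one_aux {n : ℕ} (u : Fin n × Fin 2 → ℂ) (h : norm' u = 1) :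
    ∑ k : Fin n, (‖u (k, 0)‖ ^ 2 + ‖u (k, 1)‖ ^ 2) = 1 := by
  unfold norm' at h
  rw [Real.sqrt_eq_one] at h
  rw [← h, inner', Fintype.sum_prod_type, Complex.re_sum]
  refine Finset.sum_congr rfl fun k _ => ?_
  rw [Fin.sum_univ_two]
  simp [Complex.sq_norm, Complex.normSq_apply]

lemma sum_eq_aux {n : ℕ} (ξ ξb : Fin n × Fin 2 → ℂ) (a b : Fin 3 → ℝ) :
    ∑ i, ∑ j, (a i : ℂ) * gS ξ ξb i j * (b j : ℂ)
      = ∑ k : Fin n, locT a b (ξ (k, 0)) (ξ (k, 1)) (ξb (k, 0)) (ξb (k, 1)) := by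
  simp only [gS, SigmaMat, inner', spinAct, Fintype.sum_prod_type, Matrix.of_apply,
    Matrix.trace_fin_two, Matrix.mul_apply, Fin.sum_univ_two, Fin.sum_univ_three, pauli,
    Matrix.cons_val', Matrix.cons_val_zero, Matrix.cons_val_one, Matrix.cons_val_fin_one]
  simp only [Finset.mul_sum, Finset.sum_mul, ← Finset.sum_add_distrib]
  refine Finset.sum_congr rfl fun k _ => ?_
  unfold locT
  ring

/-- For an orthonormal pair `(ξ, ξ̄)`, every bilinear contraction of the spin g-tensor
with real unit vectors is bounded by 2 in absolute value (every singular value of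
`g_S` is at most 2). -/
theorem stmt8 {n : ℕ} (ξ ξb : Fin n × Fin 2 → ℂ)
    (hξ : norm' ξ = 1) (hξb : norm' ξb = 1) (horth : inner' ξ ξb = 0)
    (a b : Fin 3 → ℝ) (ha : ∑ i, a i ^ 2 = 1) (hb : ∑ j, b j ^ 2 = 1) :
    ‖∑ i, ∑ j, (a i : ℂ) * gS ξ ξb i j * (b j : ℂ)‖ ≤ 2 := by
  rw [Fin.sum_univ_three] at ha hb
  rw [sum_eq_aux]
  refine (norm_sum_le_of_le _ fun k _ => locT_le a b ha hb _ _ _ _).trans ?_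
  rw [Finset.sum_add_distrib, norm_one_aux ξ hξ, norm_one_aux ξb hξb]
  norm_num
end

section
/- Let ξ : Fin n × Fin 2 → ℂ with ‖ξ‖ = 1, let ξ̄ be its Kramers partner, and let g_S be the spin g-tensor of the pair (ξ, ξ̄). Let X, Y ∈ ℂ with |X|² + |Y|² = 1, set u = X·ξ + Y·ξ̄, and let n ∈ ℝ³ be the Bloch vector of the spinor c = (X, Y), i.e. nⱼ = Σ_{s,s'} conj(c_s) · σⱼ(s, s') · c_{s'} for j ∈ {1, 2, 3}. Then for each i ∈ {1, 2, 3}, the spin expectation ⟨u, σᵢ u⟩ = (1/2) · Σⱼ g_S(i, j) · nⱼ. (The spin polarization of any state in the Kramers doublet is the image of its Bloch vector under half the spin g-tensor.) -/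
open Matrix Complex

theorem inner_lin {n : ℕ} (ξ η : Fin n × Fin 2 → ℂ) (X Y : ℂ) (i : Fin 3) :
    inner' (fun p => X * ξ p + Y * η p) (spinAct i (fun p => X * ξ p + Y * η p)) =
      (starRingEnd ℂ) X * X * inner' ξ (spinAct i ξ)
      + (starRingEnd ℂ) X * Y * inner' ξ (spinAct i η)
      + (starRingEnd ℂ) Y * X * inner' η (spinAct i ξ)
      + (starRingEnd ℂ) Y * Y * inner' η (spinAct i η) := by
  simp only [inner', Finset.mul_sum, ← Finset.sum_add_distrib]
  refine Finset.sum_congr rfl fun p _ => ?_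
  simp only [spinAct, Fin.sum_univ_two, map_add, map_mul]
  ring

theorem inner_kramers {n : ℕ} (ξ : Fin n × Fin 2 → ℂ) (i : Fin 3) :
    inner' (kramers ξ) (spinAct i (kramers ξ)) = - inner' ξ (spinAct i ξ) := by
  simp only [inner', Fintype.sum_prod_type, ← Finset.sum_neg_distrib]
  refine Finset.sum_congr rfl fun a _ => ?_
  fin_cases i <;> simp [spinAct, kramers, pauli, Fin.sum_univ_two] <;> ring

/-- The spin polarization of any state `u = X·ξ + Y·ξ̄` in the Kramers doublet is the
image of its Bloch vector under half the spin g-tensor: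
`⟨u, σᵢ u⟩ = (1/2) Σⱼ g_S(i,j) nⱼ`, where `nⱼ = Σ_{s,s'} conj(c_s) σⱼ(s,s') c_{s'}`
is the Bloch vector of the spinor `c = (X, Y)`. -/
theorem stmt9 {n : ℕ} (ξ : Fin n × Fin 2 → ℂ) (hξ : norm' ξ = 1)
    (X Y : ℂ) (hXY : ‖X‖ ^ 2 + ‖Y‖ ^ 2 = 1)
    (u : Fin n × Fin 2 → ℂ) (hu : u = fun p => X * ξ p + Y * kramers ξ p)
    (c : Fin 2 → ℂ) (hc : c = ![X, Y])
    (nv : Fin 3 → ℂ)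
    (hnv : ∀ j, nv j = ∑ s : Fin 2, ∑ s' : Fin 2, (starRingEnd ℂ) (c s) * pauli j s s' * c s')
    (i : Fin 3) :
    inner' u (spinAct i u) = (1 / 2 : ℂ) * ∑ j, gS ξ (kramers ξ) i j * nv j := by
  subst hu hc
  rw [inner_lin, inner_kramers]
  simp only [hnv, Fin.sum_univ_three, gS, SigmaMat, Matrix.of_apply, inner_kramers]
  generalize inner' ξ (spinAct i ξ) = p
  generalize inner' ξ (spinAct i (kramers ξ)) = q
  generalize inner' (kramers ξ) (spinAct i ξ) = r
  simp [pauli, Fin.sum_univ_two, Matrix.trace_fin_two]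
  ring_nf
  simp only [Complex.I_sq]
  ring
end

section
/- Let ξ : Fin n × Fin 2 → ℂ with ‖ξ‖ = 1, let ξ̄ be its Kramers partner, and let g_S be the spin g-tensor of the pair (ξ, ξ̄). If det(g_S) = 0, then there exist X, Y ∈ ℂ with |X|² + |Y|² = 1 such that the unit vector u = X·ξ + Y·ξ̄ has reduced spin density matrix ρ_S(u) = (1/2) · 1 (the maximally mixed state); in particular u is maximally entangled between its orbital and spin factors. -/
open Matrix Complex

/-- The real form of the g-tensor. -/
noncomputable def Greal (d : ℝ) (r α β γ : ℂ) : Matrix (Fin 3) (Fin 3) ℝ :=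
  !![2 * (β.re - α.re), 2 * (β.im - α.im), 4 * r.re;
     2 * (α.im + β.im), -2 * (α.re + β.re), -4 * r.im;
     4 * γ.re, 4 * γ.im, 2 * d]

lemma mat_two_congr {a b c d a' b' c' d' : ℂ} (ha : a = a') (hb : b = b') (hc : c = c')
    (hd : d = d') : !![a, b; c, d] = !![a', b'; c', d'] := by
  rw [ha, hb, hc, hd]

lemma gS_eq {n : ℕ} (ξ : Fin n × Fin 2 → ℂ) (d : ℝ) (r α β γ : ℂ)
    (hd : (d : ℂ) = ∑ a, (ξ (a, 0) * (starRingEnd ℂ) (ξ (a, 0))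
      - ξ (a, 1) * (starRingEnd ℂ) (ξ (a, 1))))
    (hr : r = ∑ a, ξ (a, 0) * (starRingEnd ℂ) (ξ (a, 1)))
    (hα : α = ∑ a, ξ (a, 0) * ξ (a, 0))
    (hβ : β = ∑ a, ξ (a, 1) * ξ (a, 1))
    (hγ : γ = ∑ a, ξ (a, 0) * ξ (a, 1)) :
    gS ξ (kramers ξ) = (Greal d r α β γ).map Complex.ofReal := by
  have hr' := congrArg (starRingEnd ℂ) hr
  have hα' := congrArg (starRingEnd ℂ) hα
  have hβ' := congrArg (starRingEnd ℂ) hβ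
  have hγ' := congrArg (starRingEnd ℂ) hγ
  simp only [map_sum, map_mul, Complex.conj_conj] at hr' hα' hβ' hγ'
  have e1 : ∀ (u v : Fin n × Fin 2 → ℂ), inner' u v = ∑ a,
      ((starRingEnd ℂ) (u (a, 0)) * v (a, 0) + (starRingEnd ℂ) (u (a, 1)) * v (a, 1)) := by
    intro u v
    simp [inner', Fintype.sum_prod_type]
  have S0 : SigmaMat ξ (kramers ξ) 0 = !![r + (starRingEnd ℂ) r,
      (starRingEnd ℂ) β - (starRingEnd ℂ) α; β - α, -(r + (starRingEnd ℂ) r)] := by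
    rw [hr', hα', hβ', hr, hα, hβ]
    simp only [SigmaMat, e1, spinAct, kramers, pauli, Fin.sum_univ_two,
      ← Finset.sum_add_distrib, ← Finset.sum_sub_distrib, ← Finset.sum_neg_distrib]
    refine mat_two_congr ?_ ?_ ?_ ?_ <;>
      (refine Finset.sum_congr rfl fun a _ => ?_; simp; try ring)
  have S1 : SigmaMat ξ (kramers ξ) 1 = !![I * (r - (starRingEnd ℂ) r),
      I * ((starRingEnd ℂ) β + (starRingEnd ℂ) α); -I * (β + α), -I * (r - (starRingEnd ℂ) r)] := by
    rw [hr', hα', hβ', hr, hα, hβ]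
    simp only [SigmaMat, e1, spinAct, kramers, pauli, Fin.sum_univ_two,
      ← Finset.sum_add_distrib, ← Finset.sum_sub_distrib, Finset.mul_sum]
    refine mat_two_congr ?_ ?_ ?_ ?_ <;>
      (refine Finset.sum_congr rfl fun a _ => ?_; simp; try ring)
  have S2 : SigmaMat ξ (kramers ξ) 2 = !![(d : ℂ),
      2 * (starRingEnd ℂ) γ; 2 * γ, - (d : ℂ)] := by
    rw [hγ', hd, hγ]
    simp only [SigmaMat, e1, spinAct, kramers, pauli, Fin.sum_univ_two,
      ← Finset.sum_neg_distrib, Finset.mul_sum]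
    refine mat_two_congr ?_ ?_ ?_ ?_ <;>
      (refine Finset.sum_congr rfl fun a _ => ?_; simp; try ring)
  ext i j
  fin_cases i <;> fin_cases j <;>
    simp [gS, S0, S1, S2, Greal, pauli, Matrix.trace_fin_two, Matrix.mul_apply, Fin.sum_univ_two] <;>
    apply Complex.ext <;> simp <;> ring

lemma bloch (w : Fin 3 → ℝ) (hw : w 0 ^ 2 + w 1 ^ 2 + w 2 ^ 2 = 1) :
    ∃ X Y : ℂ, X * (starRingEnd ℂ) X + Y * (starRingEnd ℂ) Y = 1 ∧
      X * (starRingEnd ℂ) X - Y * (starRingEnd ℂ) Y = w 2 ∧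
      2 * ((starRingEnd ℂ) X * Y) = w 0 + w 1 * I ∧
      2 * (X * (starRingEnd ℂ) Y) = w 0 - w 1 * I := by
  by_cases h : w 2 = -1
  · have h0 : w 0 = 0 := by rw [h] at hw; nlinarith [sq_nonneg (w 0), sq_nonneg (w 1)]
    have h1 : w 1 = 0 := by rw [h] at hw; nlinarith [sq_nonneg (w 0), sq_nonneg (w 1)]
    exact ⟨0, 1, by simp, by simp [h], by simp [h0, h1], by simp [h0, h1]⟩
  · have hpos : 0 < (1 + w 2) / 2 := by
      have : -1 ≤ w 2 := by nlinarith [sq_nonneg (w 0), sq_nonneg (w 1)]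
      have := lt_of_le_of_ne this (Ne.symm h)
      linarith
    obtain ⟨x, hx0, hx⟩ : ∃ x : ℝ, 0 < x ∧ x ^ 2 = (1 + w 2) / 2 :=
      ⟨√((1 + w 2) / 2), Real.sqrt_pos.2 hpos, Real.sq_sqrt hpos.le⟩
    have hxc : (x : ℂ) ≠ 0 := by exact_mod_cast hx0.ne'
    have hY : (((w 0 : ℂ) + w 1 * I) / (2 * x)) * (((w 0 : ℂ) - w 1 * I) / (2 * x))
        = ((1 - w 2) / 2 : ℝ) := by
      have e : (w 0 ^ 2 + w 1 ^ 2) = (1 - w 2) / 2 * (4 * x ^ 2) := by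
        rw [hx]; linear_combination hw
      have e' : ((w 0 : ℂ) ^ 2 + (w 1 : ℂ) ^ 2) = ((1 - w 2) / 2 : ℝ) * (4 * (x : ℂ) ^ 2) := by
        exact_mod_cast e
      rw [div_mul_div_comm, div_eq_iff (by simp [hxc])]
      linear_combination e' - (w 1 : ℂ) ^ 2 * I_sq
    have hx' : (x : ℂ) * x = ((1 + w 2) / 2 : ℝ) := by rw [← hx]; push_cast; ring
    have hc : (starRingEnd ℂ) (((w 0 : ℂ) + w 1 * I) / (2 * x))
        = ((w 0 : ℂ) - w 1 * I) / (2 * x) := by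
      have h2 : (starRingEnd ℂ) (2 : ℂ) = 2 := Complex.conj_ofNat 2
      simp [map_div₀, sub_eq_add_neg, h2]
    refine ⟨x, ((w 0 : ℂ) + w 1 * I) / (2 * x), ?_, ?_, ?_, ?_⟩
    · rw [hc, hY, conj_ofReal, hx']; push_cast; ring
    · rw [hc, hY, conj_ofReal, hx']; push_cast; ring
    · rw [conj_ofReal]; field_simp
    · rw [hc]; field_simp

theorem stmt10 {n : ℕ} (ξ : Fin n × Fin 2 → ℂ) (hξ : norm' ξ = 1)
    (hdet : (gS ξ (kramers ξ)).det = 0) :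
    ∃ X Y : ℂ, ‖X‖ ^ 2 + ‖Y‖ ^ 2 = 1 ∧
      rhoS (fun p => X * ξ p + Y * kramers ξ p) =
        (1 / 2 : ℂ) • (1 : Matrix (Fin 2) (Fin 2) ℂ) := by
  obtain ⟨p, hp⟩ : ∃ p : ℝ, (p : ℂ) = ∑ a, ξ (a, 0) * (starRingEnd ℂ) (ξ (a, 0)) :=
    ⟨∑ a, normSq (ξ (a, 0)), by simp [mul_conj]⟩
  obtain ⟨q, hq⟩ : ∃ q : ℝ, (q : ℂ) = ∑ a, ξ (a, 1) * (starRingEnd ℂ) (ξ (a, 1)) :=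
    ⟨∑ a, normSq (ξ (a, 1)), by simp [mul_conj]⟩
  have hin : inner' ξ ξ = ((p + q : ℝ) : ℂ) := by
    push_cast
    rw [hp, hq, ← Finset.sum_add_distrib]
    simp [inner', Fintype.sum_prod_type, mul_comm]
  have hpq : p + q = 1 := by
    rw [norm', hin, ofReal_re, Real.sqrt_eq_one] at hξ
    exact hξ
  have hpqc : (p : ℂ) + q = 1 := by exact_mod_cast hpq
  obtain ⟨r, hr⟩ : ∃ r, r = ∑ a, ξ (a, 0) * (starRingEnd ℂ) (ξ (a, 1)) := ⟨_, rfl⟩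
  obtain ⟨α, hα⟩ : ∃ r, r = ∑ a, ξ (a, 0) * ξ (a, 0) := ⟨_, rfl⟩
  obtain ⟨β, hβ⟩ : ∃ r, r = ∑ a, ξ (a, 1) * ξ (a, 1) := ⟨_, rfl⟩
  obtain ⟨γ, hγ⟩ : ∃ r, r = ∑ a, ξ (a, 0) * ξ (a, 1) := ⟨_, rfl⟩
  rw [gS_eq ξ (p - q) r α β γ (by push_cast; rw [hp, hq, Finset.sum_sub_distrib]) hr hα hβ hγ]
    at hdet
  have hdet' : (Greal (p - q) r α β γ).det = 0 := by
    have := RingHom.map_det Complex.ofRealHom (Greal (p - q) r α β γ)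
    have h2 : ((Greal (p - q) r α β γ).det : ℂ) = 0 := this.trans hdet
    exact_mod_cast h2
  obtain ⟨v, hv0, hv⟩ := Matrix.exists_mulVec_eq_zero_iff.2 hdet'
  obtain ⟨w, hw1, hw⟩ : ∃ w : Fin 3 → ℝ, w 0 ^ 2 + w 1 ^ 2 + w 2 ^ 2 = 1 ∧
      Greal (p - q) r α β γ *ᵥ w = 0 := by
    have hpos : 0 < v 0 ^ 2 + v 1 ^ 2 + v 2 ^ 2 := by
      by_contra hn
      apply hv0
      have a0 : v 0 = 0 := by nlinarith [sq_nonneg (v 0), sq_nonneg (v 1), sq_nonneg (v 2)]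
      have a1 : v 1 = 0 := by nlinarith [sq_nonneg (v 0), sq_nonneg (v 1), sq_nonneg (v 2)]
      have a2 : v 2 = 0 := by nlinarith [sq_nonneg (v 0), sq_nonneg (v 1), sq_nonneg (v 2)]
      ext i; fin_cases i <;> simp [a0, a1, a2]
    refine ⟨(√(v 0 ^ 2 + v 1 ^ 2 + v 2 ^ 2))⁻¹ • v, ?_, by rw [Matrix.mulVec_smul, hv, smul_zero]⟩
    simp only [Pi.smul_apply, smul_eq_mul, mul_pow, inv_pow, Real.sq_sqrt hpos.le]
    field_simp
  have w0 := congrFun hw 0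
  have w1 := congrFun hw 1
  have w2 := congrFun hw 2
  simp [Greal, Matrix.mulVec, dotProduct, Fin.sum_univ_three] at w0 w1 w2
  obtain ⟨X, Y, h1, h2, h3, h4⟩ := bloch w hw1
  have hr' := congrArg (starRingEnd ℂ) hr
  have hα' := congrArg (starRingEnd ℂ) hα
  have hβ' := congrArg (starRingEnd ℂ) hβ
  have hγ' := congrArg (starRingEnd ℂ) hγ
  simp only [map_sum, map_mul, Complex.conj_conj] at hr' hα' hβ' hγ'
  have c2 : (w 2 : ℂ) * (p - q) + (w 0 - w 1 * I) * γ + (w 0 + w 1 * I) * (starRingEnd ℂ) γ = 0 := by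
    apply Complex.ext <;> simp <;> linarith
  have c1 : 2 * (w 2 : ℂ) * r - (w 0 - w 1 * I) * α + (w 0 + w 1 * I) * (starRingEnd ℂ) β = 0 := by
    apply Complex.ext <;> simp <;> linarith
  have c1' : 2 * (w 2 : ℂ) * (starRingEnd ℂ) r - (w 0 + w 1 * I) * (starRingEnd ℂ) α
      + (w 0 - w 1 * I) * β = 0 := by
    apply Complex.ext <;> simp <;> linarith
  rw [← h2, ← h3, ← h4] at c2 c1 c1'
  refine ⟨X, Y, ?_, ?_⟩
  · rw [mul_conj, mul_conj, normSq_eq_norm_sq, normSq_eq_norm_sq] at h1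
    exact_mod_cast h1
  have r00 : rhoS (fun p => X * ξ p + Y * kramers ξ p) 0 0 =
      X * (starRingEnd ℂ) X * p + Y * (starRingEnd ℂ) Y * q + X * (starRingEnd ℂ) Y * γ
        + (starRingEnd ℂ) X * Y * (starRingEnd ℂ) γ := by
    rw [hγ', hγ, hp, hq]
    simp only [rhoS, kramers, Matrix.of_apply, Finset.mul_sum, ← Finset.sum_add_distrib]
    refine Finset.sum_congr rfl fun a _ => ?_
    simp; ring
  have r11 : rhoS (fun p => X * ξ p + Y * kramers ξ p) 1 1 =
      X * (starRingEnd ℂ) X * q + Y * (starRingEnd ℂ) Y * p - X * (starRingEnd ℂ) Y * γ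
        - (starRingEnd ℂ) X * Y * (starRingEnd ℂ) γ := by
    rw [hγ', hγ, hp, hq]
    simp only [rhoS, kramers, Matrix.of_apply, Finset.mul_sum, ← Finset.sum_add_distrib,
      ← Finset.sum_sub_distrib]
    refine Finset.sum_congr rfl fun a _ => ?_
    simp; ring
  have r01 : rhoS (fun p => X * ξ p + Y * kramers ξ p) 0 1 =
      X * (starRingEnd ℂ) X * r - Y * (starRingEnd ℂ) Y * r - X * (starRingEnd ℂ) Y * α
        + (starRingEnd ℂ) X * Y * (starRingEnd ℂ) β := by
    rw [hβ', hα, hr]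
    simp only [rhoS, kramers, Matrix.of_apply, Finset.mul_sum, ← Finset.sum_add_distrib,
      ← Finset.sum_sub_distrib]
    refine Finset.sum_congr rfl fun a _ => ?_
    simp; ring
  have r10 : rhoS (fun p => X * ξ p + Y * kramers ξ p) 1 0 =
      X * (starRingEnd ℂ) X * (starRingEnd ℂ) r - Y * (starRingEnd ℂ) Y * (starRingEnd ℂ) r
        - (starRingEnd ℂ) X * Y * (starRingEnd ℂ) α + X * (starRingEnd ℂ) Y * β := by
    rw [hα', hr', hβ]
    simp only [rhoS, kramers, Matrix.of_apply, Finset.mul_sum, ← Finset.sum_add_distrib,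
      ← Finset.sum_sub_distrib]
    refine Finset.sum_congr rfl fun a _ => ?_
    simp; ring
  ext i j
  fin_cases i <;> fin_cases j
  · show rhoS (fun p => X * ξ p + Y * kramers ξ p) 0 0 = _
    rw [r00]; simp
    linear_combination c2 / 2 + h1 * (p + q) / 2 + hpqc / 2
  · show rhoS (fun p => X * ξ p + Y * kramers ξ p) 0 1 = _
    rw [r01]; simp
    linear_combination c1 / 2
  · show rhoS (fun p => X * ξ p + Y * kramers ξ p) 1 0 = _
    rw [r10]; simp
    linear_combination c1' / 2
  · show rhoS (fun p => X * ξ p + Y * kramers ξ p) 1 1 = _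
    rw [r11]; simp
    linear_combination -c2 / 2 + h1 * (p + q) / 2 + hpqc / 2
end
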